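/- arXiv:1306.4628 — 5 statements merged into one kernel-verified Lean document; each statement's English description precedes it below -/
import Mathlib

section
/- Let α be a permutation of {1,…,n} and let τ = (i j) be the transposition exchanging two distinct elements i and j. Then z(τ∘α) = z(α∘τ), and this common value equals z(α)+1 if i and j belong to the same cycle (orbit) of α, and equals z(α)−1 if i and j belong to different cycles of α. -/
/-- The setoid on `Fin n` whose equivalence classes are the cycles (orbits) of the
permutation `α`. -/
def cycleSetoid {n : ℕ} (α : Equiv.Perm (Fin n)) : Setoid (Fin n) :=
  ⟨α.SameCycle,
    ⟨fun x => Equiv.Perm.SameCycle.refl α x, fun h => h.symm, fun h h' => h.trans h'⟩⟩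

/-- `zPerm α` is the number of cycles of `α`, i.e. the number of orbits of `⟨α⟩` acting
on `Fin n` (fixed points counting as cycles). -/
noncomputable def zPerm {n : ℕ} (α : Equiv.Perm (Fin n)) : ℕ :=
  Nat.card (Quotient (cycleSetoid α))

/-- A function invariant under `β` is constant on the cycles of `β`. -/
theorem Equiv.Perm.SameCycle.apply_eq_of_invariant {X Y : Type*} {β : Equiv.Perm X} {g : X → Y}
    (hg : ∀ x, g (β x) = g x) {x y : X} (h : β.SameCycle x y) : g x = g y := by
  obtain ⟨m, rfl⟩ := h
  induction m with
  | zero => simp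
  | succ m ih => rw [add_comm, zpow_add, zpow_one, mul_apply, hg, ih]
  | pred m ih => rw [ih, ← hg ((β ^ (-(m : ℤ) - 1)) x), ← mul_apply, ← zpow_one_add, add_sub_cancel]

/-- If `i` returns to itself after `k` steps without having met `j`, then `j` is not in the
cycle of `i`. -/
theorem Equiv.Perm.not_sameCycle_of_pow_apply_eq_self {X : Type*} [Finite X]
    {α : Equiv.Perm X} {i j : X} {k : ℕ} (hk : 0 < k) (hki : (α ^ k) i = i)
    (hne : ∀ m < k, (α ^ m) i ≠ j) : ¬ α.SameCycle i j := by
  intro h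
  obtain ⟨m, -, hm⟩ := h.exists_pow_eq'
  refine hne (m % k) (Nat.mod_lt _ hk) ?_
  have hfix : ((α ^ k) ^ (m / k)) i = i := pow_apply_eq_self_of_apply_eq_self hki _
  rw [← hm]
  conv_rhs => rw [← Nat.mod_add_div m k, pow_add, pow_mul, mul_apply, hfix]

/-- Exactly one of `α` and `swap i j * α` has `i` and `j` in the same cycle. -/
theorem Equiv.Perm.sameCycle_swap_mul_iff {X : Type*} [Finite X] [DecidableEq X]
    (α : Equiv.Perm X) {i j : X} (hij : i ≠ j) :
    (Equiv.swap i j * α).SameCycle i j ↔ ¬ α.SameCycle i j := by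
  have hex : ∃ k, 0 < k ∧ ((α ^ k) i = i ∨ (α ^ k) i = j) :=
    ⟨orderOf α, orderOf_pos α, Or.inl (by simp [pow_orderOf_eq_one])⟩
  obtain ⟨hk, hcase⟩ := Nat.find_spec hex
  have hmin := fun m (hm : m < Nat.find hex) => Nat.find_min hex hm
  generalize Nat.find hex = k at hk hcase hmin
  have hpow : ∀ m < k, ((Equiv.swap i j * α) ^ m) i = (α ^ m) i := by
    intro m
    induction m with
    | zero => simp
    | succ m ih =>
      intro hm
      have h := not_or.1 fun h => hmin _ hm ⟨m.succ_pos, h⟩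
      rw [pow_succ', mul_apply, ih (by omega), mul_apply, ← mul_apply α, ← pow_succ']
      exact Equiv.swap_apply_of_ne_of_ne h.1 h.2
  have hne : ∀ m < k, (α ^ m) i ≠ j := by
    intro m hm h
    rcases Nat.eq_zero_or_pos m with rfl | h0
    · exact hij h
    · exact hmin m hm ⟨h0, Or.inr h⟩
  have hlast : ((Equiv.swap i j * α) ^ k) i = Equiv.swap i j ((α ^ k) i) := by
    obtain ⟨l, rfl⟩ := Nat.exists_eq_add_one.2 hk
    rw [pow_succ', mul_apply, hpow l (by omega), mul_apply, ← mul_apply α, ← pow_succ']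
  rcases hcase with h | h
  · rw [h, Equiv.swap_apply_left] at hlast
    exact iff_of_true ⟨k, by exact_mod_cast hlast⟩ (not_sameCycle_of_pow_apply_eq_self hk h hne)
  · rw [h, Equiv.swap_apply_right] at hlast
    exact iff_of_false
      (not_sameCycle_of_pow_apply_eq_self hk hlast fun m hm => hpow m hm ▸ hne m hm)
      (not_not.2 ⟨k, by exact_mod_cast h⟩)

/-- Multiplying by a transposition of elements of different cycles merges these cycles. -/
theorem zPerm_swap_mul_add_one_of_not_sameCycle {n : ℕ} {α : Equiv.Perm (Fin n)} {i j : Fin n}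
    (h : ¬ α.SameCycle i j) : zPerm (Equiv.swap i j * α) + 1 = zPerm α := by
  classical
  have hij : i ≠ j := fun e => h (e ▸ Equiv.Perm.SameCycle.refl α i)
  have hβ := (α.sameCycle_swap_mul_iff hij).2 h
  set β := Equiv.swap i j * α
  have hβ_apply : ∀ x, β x = Equiv.swap i j (α x) := fun _ => rfl
  let p : Fin n → Quotient (cycleSetoid α) := Quotient.mk _
  let q : Fin n → Quotient (cycleSetoid β) := Quotient.mk _
  have hp_iff : ∀ {x y}, p x = p y ↔ α.SameCycle x y := Quotient.eq
  have hq_iff : ∀ {x y}, q x = q y ↔ β.SameCycle x y := Quotient.eq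
  have hp : ∀ x, p (α x) = p x := fun x => hp_iff.2 (Equiv.Perm.sameCycle_apply_left.2 (.refl _ _))
  have hpij : p i ≠ p j := fun e => h (hp_iff.1 e)
  have hqij : q i = q j := hq_iff.2 hβ
  have hqα : ∀ x, q (α x) = q x := by
    intro x
    have hx : q (β x) = q x := hq_iff.2 (Equiv.Perm.sameCycle_apply_left.2 (.refl _ _))
    rw [← hx, hβ_apply, Equiv.swap_apply_def]
    split_ifs with h1 h2
    · rw [h1, hqij]
    · rw [h2, hqij]
    · rfl
  let g : Fin n → {c // c ≠ p j} := fun x => if hx : p x = p j then ⟨p i, hpij⟩ else ⟨p x, hx⟩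
  have hgij : g i = g j := by simp [g, hpij]
  have hgα : ∀ x, g (α x) = g x := fun x => by simp only [g, hp]
  have hgβ : ∀ x, g (β x) = g x := by
    intro x
    rw [← hgα x, hβ_apply, Equiv.swap_apply_def]
    split_ifs with h1 h2
    · rw [h1, hgij]
    · rw [h2, hgij]
    · rfl
  let e : Quotient (cycleSetoid β) ≃ {c // c ≠ p j} :=
    { toFun := Quotient.lift g fun _ _ hxy =>
        Equiv.Perm.SameCycle.apply_eq_of_invariant hgβ hxy
      invFun := fun c => Quotient.lift q
        (fun _ _ hxy => Equiv.Perm.SameCycle.apply_eq_of_invariant hqα hxy) c.1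
      left_inv := by
        refine Quotient.ind fun x => ?_
        change Quotient.lift q _ (g x).1 = q x
        by_cases hx : p x = p j
        · have hqx : q x = q j :=
            Equiv.Perm.SameCycle.apply_eq_of_invariant hqα (hp_iff.1 hx)
          simp only [g, dif_pos hx]
          exact hqij.trans hqx.symm
        · simp only [g, dif_neg hx]
          rfl
      right_inv := by
        rintro ⟨c, hc⟩
        induction c using Quotient.ind with
        | _ x => exact dif_neg hc }
  have hcard := Nat.card_congr (Equiv.sumCompl fun c => c = p j)
  rw [Nat.card_sum, Nat.card_unique] at hcard
  rw [zPerm, zPerm, Nat.card_congr e, ← hcard, add_comm]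

/-- The number of cycles is invariant under conjugation. -/
theorem zPerm_conj {n : ℕ} (σ α : Equiv.Perm (Fin n)) : zPerm (σ * α * σ⁻¹) = zPerm α := by
  refine Nat.card_congr (Quotient.congr σ⁻¹ fun x y => ?_)
  exact Equiv.Perm.sameCycle_conj

/-- Multiplying a permutation `α` by a transposition `τ = (i j)` (on either side)
changes its number of cycles by one: it increases by one if `i` and `j` lie in the
same cycle of `α`, and decreases by one otherwise; moreover `z(τ∘α) = z(α∘τ)`. -/
theorem zPerm_mul_swap (n : ℕ) (α : Equiv.Perm (Fin n)) (i j : Fin n) (hij : i ≠ j) :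
    zPerm (Equiv.swap i j * α) = zPerm (α * Equiv.swap i j) ∧
    (α.SameCycle i j → zPerm (Equiv.swap i j * α) = zPerm α + 1) ∧
    (¬ α.SameCycle i j → zPerm (Equiv.swap i j * α) + 1 = zPerm α) := by
  refine ⟨?_, fun h => ?_, zPerm_swap_mul_add_one_of_not_sameCycle⟩
  · rw [← zPerm_conj (Equiv.swap i j) (α * Equiv.swap i j)]
    simp [mul_assoc]
  · have h' := (α.sameCycle_swap_mul_iff hij).not.2 (not_not.2 h)
    simpa using (zPerm_swap_mul_add_one_of_not_sameCycle h').symm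
end

section
/- For any permutation α of {1,…,n} (n ≥ 1), the number of back points of α plus the number of back points of α⁻¹ ∘ ζ_n equals 2·g(α), i.e., equals n + 1 − z(α) − z(α⁻¹ ∘ ζ_n). -/
/-- `α` has genus one, i.e. `z(α) + z(α⁻¹ ∘ ζₙ) = n - 1` (written additively).
Here `finRotate n` plays the role of the cycle `ζₙ = (1, 2, …, n)`. -/
def IsGenusOne {n : ℕ} (α : Equiv.Perm (Fin n)) : Prop :=
  zPerm α + zPerm (α⁻¹ * finRotate n) + 2 = n + 1

/-- `i` is a back point of `α`: `α i < i` and `α i` is not the smallest element of the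
cycle (orbit) of `α` containing `i`. -/
def IsBackPoint {n : ℕ} (α : Equiv.Perm (Fin n)) (i : Fin n) : Prop :=
  α i < i ∧ ∃ j : Fin n, α.SameCycle i j ∧ j < α i

/-- The number of back points of `α`. -/
noncomputable def backPointCount {n : ℕ} (α : Equiv.Perm (Fin n)) : ℕ :=
  Nat.card {i : Fin n // IsBackPoint α i}

/-- `α` is the permutation associated with a set partition (each block of the partition
is a cycle of `α`, traversed in increasing order); equivalently, `α` has no back point. -/
def IsPartitionPerm {n : ℕ} (α : Equiv.Perm (Fin n)) : Prop :=
  ∀ i : Fin n, ¬ IsBackPoint α i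

/-- Every cycle contains exactly one preimage of its smallest element, so the number of cycles is
the number of such preimages. -/
theorem zPerm_eq_card_maps_to_min {n : ℕ} (α : Equiv.Perm (Fin n)) :
    zPerm α = Nat.card {i : Fin n // ∀ j, α.SameCycle i j → α i ≤ j} := by
  refine (Nat.card_eq_of_bijective
    (fun i : {i : Fin n // ∀ j, α.SameCycle i j → α i ≤ j} =>
      (Quotient.mk (cycleSetoid α) i.1)) ⟨?_, ?_⟩).symm
  · rintro ⟨i, hi⟩ ⟨k, hk⟩ h
    have hik : α.SameCycle i k := Quotient.exact h
    exact Subtype.ext <| α.injective <| le_antisymm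
      (hi _ (Equiv.Perm.sameCycle_apply_right.2 hik))
      (hk _ (Equiv.Perm.sameCycle_apply_right.2 hik.symm))
  · intro q
    induction q using Quotient.inductionOn with
    | h x =>
      obtain ⟨m, hm, hmin⟩ := Set.exists_min_image {j | α.SameCycle x j} id
        (Set.toFinite _) ⟨x, Equiv.Perm.SameCycle.refl α x⟩
      have hx : α.SameCycle x (α⁻¹ m) := Equiv.Perm.sameCycle_symm_apply_right.2 hm
      refine ⟨⟨α⁻¹ m, fun j hj => ?_⟩, Quotient.sound hx.symm⟩
      simpa using hmin j (hx.trans hj)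

/-- The weak descents of `α` are its back points together with the preimages of cycle minima. -/
theorem backPointCount_add_zPerm {n : ℕ} (α : Equiv.Perm (Fin n)) :
    backPointCount α + zPerm α = Nat.card {i : Fin n // α i ≤ i} := by
  classical
  rw [zPerm_eq_card_maps_to_min, backPointCount]
  simp only [Nat.card_eq_fintype_card, Fintype.card_subtype]
  rw [← Finset.card_union_of_disjoint]
  · congr 1
    ext i
    simp only [Finset.mem_union, Finset.mem_filter, Finset.mem_univ, true_and]
    constructor
    · rintro (h | h)
      · exact h.1.le
      · exact h i (Equiv.Perm.SameCycle.refl α i)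
    · intro h
      by_cases hmin : ∀ j, α.SameCycle i j → α i ≤ j
      · exact Or.inr hmin
      · push Not at hmin
        refine Or.inl ⟨lt_of_le_of_ne h fun hfix => ?_, hmin⟩
        obtain ⟨j, hj, hlt⟩ := hmin
        have hij : i = j := hj.eq_of_left hfix
        exact hlt.ne (hij ▸ hfix.symm)
  · rw [Finset.disjoint_filter]
    rintro i - ⟨-, j, hj, hlt⟩ h
    exact hlt.not_ge (h j hj)

/-- A point `j` lies weakly below the cyclic predecessor of `k` iff `j < k` or `k = 0`. -/
theorem le_finRotate_symm_iff {m : ℕ} (j k : Fin (m + 1)) :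
    j ≤ (finRotate (m + 1)).symm k ↔ j < k ∨ k = 0 := by
  obtain ⟨i, rfl⟩ := (finRotate (m + 1)).surjective k
  rw [Equiv.symm_apply_apply]
  rcases eq_or_ne i (Fin.last m) with rfl | hi
  · simp [Fin.le_last]
  · have hv := coe_finRotate_of_ne_last hi
    rw [Fin.le_def, Fin.lt_def, Fin.ext_iff, hv, Fin.val_zero]
    omega

/-- The weak descents of `α` and of `α⁻¹ * finRotate n` number `n + 1` in total. -/
theorem card_apply_le_add_card_inv_mul_finRotate_apply_le (m : ℕ)
    (α : Equiv.Perm (Fin (m + 1))) :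
    Nat.card {i // α i ≤ i} + Nat.card {i // (α⁻¹ * finRotate (m + 1)) i ≤ i} = m + 1 + 1 := by
  have hβ : Nat.card {i // (α⁻¹ * finRotate (m + 1)) i ≤ i} =
      Nat.card {j // j < α j ∨ α j = 0} := by
    refine Nat.card_congr ((α⁻¹ * finRotate (m + 1)).subtypeEquiv fun i => ?_)
    rw [← le_finRotate_symm_iff]
    simp
  have hzero : (Finset.univ.filter fun j => α j = 0).card = 1 :=
    Finset.card_eq_one.2 ⟨α.symm 0, by ext j; simp [Equiv.eq_symm_apply]⟩
  have hsplit := Finset.card_filter_add_card_filter_not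
    (s := (Finset.univ : Finset (Fin (m + 1)))) (fun j => α j ≤ j)
  rw [hβ]
  simp only [Nat.card_eq_fintype_card, Fintype.card_subtype, Finset.filter_or]
  rw [Finset.card_union_of_disjoint, hzero]
  · simp only [not_le, Finset.card_univ, Fintype.card_fin] at hsplit
    omega
  · rw [Finset.disjoint_filter]
    intro j _ hlt h0
    simp [h0] at hlt

/-- For any permutation `α` of `{1,…,n}` (`n ≥ 1`), the number of back points of `α`
plus the number of back points of `α⁻¹ ∘ ζₙ` equals
`2·g(α) = n + 1 − z(α) − z(α⁻¹ ∘ ζₙ)` (written additively). -/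
theorem backPointCount_add_eq_two_mul_genus (n : ℕ) (hn : 1 ≤ n) (α : Equiv.Perm (Fin n)) :
    backPointCount α + backPointCount (α⁻¹ * finRotate n) +
        (zPerm α + zPerm (α⁻¹ * finRotate n)) = n + 1 := by
  have hα := backPointCount_add_zPerm α
  have hβ := backPointCount_add_zPerm (α⁻¹ * finRotate n)
  obtain ⟨m, rfl⟩ := Nat.exists_eq_add_of_le' hn
  have hsum := card_apply_le_add_card_inv_mul_finRotate_apply_le m α
  omega
end

section
/- Let α be a permutation of {1,…,n} and suppose there exist integers 1 ≤ a < b ≤ c < d ≤ n such that the permutation θ = ζ_n ∘ (a c) ∘ (b d) satisfies z(α) + z(α⁻¹ ∘ θ) = n + 1 (i.e., the hypermap (θ, α) has genus 0). Then the genus of α is 0 or 1, i.e., z(α) + z(α⁻¹ ∘ ζ_n) ∈ {n+1, n−1}. -/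
open Equiv Equiv.Perm

theorem zPerm_add_card_support {n : ℕ} (σ : Perm (Fin n)) :
    zPerm σ + σ.support.card = σ.cycleFactorsFinset.card + n := by
  classical
  let g : Fin n → Perm (Fin n) ⊕ Fin n := fun x =>
    if σ x = x then Sum.inr x else Sum.inl (σ.cycleOf x)
  have hker : cycleSetoid σ = Setoid.ker g := by
    ext x y
    change σ.SameCycle x y ↔ g x = g y
    constructor
    · intro h
      by_cases hx : σ x = x
      · rw [h.eq_of_left hx]
      · have hy : σ y ≠ y := fun hy => hx (h.apply_eq_self_iff.2 hy)
        simp only [g, hx, hy, if_false, h.cycleOf_eq]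
    · intro h
      by_cases hx : σ x = x <;> by_cases hy : σ y = y <;>
        simp only [g, hx, hy, if_true, if_false, Sum.inr.injEq, Sum.inl.injEq, reduceCtorEq] at h
      · rw [h]
      · exact (sameCycle_iff_cycleOf_eq_of_mem_support (mem_support.2 hx) (mem_support.2 hy)).2 h
  have himage : Finset.univ.image g = σ.cycleFactorsFinset.disjSum σ.supportᶜ := by
    ext (c | x)
    · simp only [Finset.mem_image, Finset.mem_univ, true_and, Finset.inl_mem_disjSum]
      constructor
      · rintro ⟨x, hx⟩
        by_cases h : σ x = x <;> simp only [g, h, if_true, if_false, reduceCtorEq,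
          Sum.inl.injEq] at hx
        rw [← hx]
        exact cycleOf_mem_cycleFactorsFinset_iff.2 (mem_support.2 h)
      · intro hc
        obtain ⟨x, hx⟩ := (mem_cycleFactorsFinset_iff.1 hc).1.nonempty_support
        have h : σ x ≠ x := mem_support.1 (mem_cycleFactorsFinset_support_le hc hx)
        exact ⟨x, by simp only [g, h, if_false, cycle_is_cycleOf hx hc]⟩
    · simp only [Finset.mem_image, Finset.mem_univ, true_and, Finset.inr_mem_disjSum,
        Finset.mem_compl, notMem_support]
      constructor
      · rintro ⟨y, hy⟩
        by_cases h : σ y = y <;> simp only [g, h, if_true, if_false, reduceCtorEq,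
          Sum.inr.injEq] at hy
        rwa [← hy]
      · intro h
        exact ⟨x, by simp only [g, h, if_true]⟩
  have hz : zPerm σ = (Finset.univ.image g).card := by
    rw [zPerm, hker, Nat.card_congr (Setoid.quotientKerEquivRange g), Nat.card_coe_set_eq,
      ← Set.ncard_coe_finset, Finset.coe_image, Finset.coe_univ, Set.image_univ]
  have hcompl := Finset.card_add_card_compl σ.support
  rw [Fintype.card_fin] at hcompl
  rw [hz, himage, Finset.card_disjSum]
  omega

theorem sign_eq_neg_one_pow_zPerm {n : ℕ} (σ : Perm (Fin n)) :
    sign σ = (-1) ^ (n + zPerm σ) := by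
  have h := zPerm_add_card_support σ
  have hc : Multiset.card σ.cycleType = σ.cycleFactorsFinset.card := by
    simp [cycleType_def]
  rw [sign_of_cycleType, sum_cycleType, hc]
  exact pow_eq_pow_of_modEq (n := 2) (by unfold Nat.ModEq; omega) (by simp)

theorem zPerm_swap {n : ℕ} {x y : Fin n} (h : x ≠ y) : zPerm (swap x y) + 1 = n := by
  have := zPerm_add_card_support (swap x y)
  rw [card_support_swap h, (isCycle_swap h).cycleFactorsFinset_eq_singleton,
    Finset.card_singleton] at this
  omega

theorem zPerm_finRotate {n : ℕ} (h : 2 ≤ n) : zPerm (finRotate n) = 1 := by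
  have := zPerm_add_card_support (finRotate n)
  rw [support_finRotate_of_le h, (isCycle_finRotate_of_le h).cycleFactorsFinset_eq_singleton,
    Finset.card_singleton, Finset.card_univ, Fintype.card_fin] at this
  omega

/-- The space of rational functions on `Fin n` that are invariant under `σ`. -/
def invariantFunctions {n : ℕ} (σ : Perm (Fin n)) : Submodule ℚ (Fin n → ℚ) where
  carrier := {f | ∀ x, f (σ x) = f x}
  add_mem' hf hg x := by simp [hf x, hg x]
  zero_mem' _ := rfl
  smul_mem' c f hf x := by simp [hf x]

theorem apply_eq_of_sameCycle {n : ℕ} {σ : Perm (Fin n)} {f : Fin n → ℚ}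
    (hf : f ∈ invariantFunctions σ) {x y : Fin n} (h : σ.SameCycle x y) : f x = f y := by
  obtain ⟨k, -, rfl⟩ := h.exists_pow_eq'
  induction k with
  | zero => rfl
  | succ k ih => rw [pow_succ', mul_apply, hf, ← ih ⟨k, by simp⟩]

/-- Invariant functions are the functions on the set of cycles. -/
def invariantFunctionsEquiv {n : ℕ} (σ : Perm (Fin n)) :
    invariantFunctions σ ≃ₗ[ℚ] (Quotient (cycleSetoid σ) → ℚ) where
  toFun f := Quotient.lift f.1 fun _ _ h => apply_eq_of_sameCycle f.2 h
  invFun f := ⟨fun x => f ⟦x⟧, fun x =>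
    congrArg f (Quotient.sound (sameCycle_apply_left.2 (SameCycle.refl σ x)))⟩
  map_add' f g := by ext ⟨x⟩; rfl
  map_smul' c f := by ext ⟨x⟩; rfl
  left_inv f := rfl
  right_inv f := by ext ⟨x⟩; rfl

theorem finrank_invariantFunctions {n : ℕ} (σ : Perm (Fin n)) :
    Module.finrank ℚ (invariantFunctions σ) = zPerm σ := by
  classical
  let _ : Fintype (Quotient (cycleSetoid σ)) := Fintype.ofFinite _
  rw [(invariantFunctionsEquiv σ).finrank_eq, Module.finrank_fintype_fun_eq_card, zPerm,
    Nat.card_eq_fintype_card]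

theorem zPerm_add_le {n : ℕ} (α β : Perm (Fin n)) :
    zPerm α + zPerm β ≤ n + zPerm (α * β) := by
  simp only [← finrank_invariantFunctions]
  rw [← Submodule.finrank_sup_add_finrank_inf_eq]
  refine add_le_add ?_ (Submodule.finrank_mono ?_)
  · simpa using Submodule.finrank_le (invariantFunctions α ⊔ invariantFunctions β)
  · rintro f ⟨hα, hβ⟩ x
    rw [mul_apply, hα, hβ]

theorem zPerm_le_zPerm_mul_swap {n : ℕ} (σ : Perm (Fin n)) {x y : Fin n} (h : x ≠ y) :
    zPerm σ ≤ zPerm (σ * swap x y) + 1 := by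
  have h₁ := zPerm_add_le σ (swap x y)
  have h₂ := zPerm_swap h
  omega

/-- If for some points `a < b ≤ c < d` of `Fin n` the `n`-cycle
`θ = ζₙ ∘ (a c) ∘ (b d)` makes the hypermap `(θ, α)` have genus 0, then the genus of
`α` is 0 or 1: `z(α) + z(α⁻¹ ∘ ζₙ) ∈ {n+1, n−1}`. -/
theorem genus_le_one_of_separating_points (n : ℕ) (α : Equiv.Perm (Fin n))
    (a b c d : Fin n) (hab : a < b) (hbc : b ≤ c) (hcd : c < d)
    (hθ : zPerm α +
        zPerm (α⁻¹ * (finRotate n * Equiv.swap a c * Equiv.swap b d)) = n + 1) :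
    zPerm α + zPerm (α⁻¹ * finRotate n) = n + 1 ∨
      zPerm α + zPerm (α⁻¹ * finRotate n) = n - 1 := by
  have hac : a ≠ c := (hab.trans_le hbc).ne
  have hbd : b ≠ d := (hbc.trans_lt hcd).ne
  have hn : 2 ≤ n := by have := hab; have := b.isLt; omega
  set θ := finRotate n * swap a c * swap b d with hθ_def
  have hmul : α⁻¹ * θ * swap b d * swap a c = α⁻¹ * finRotate n := by
    simp [hθ_def, mul_assoc]
  have hupper := zPerm_add_le α (α⁻¹ * finRotate n)
  rw [mul_inv_cancel_left, zPerm_finRotate hn] at hupper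
  have hlower₁ := zPerm_le_zPerm_mul_swap (α⁻¹ * θ) hbd
  have hlower₂ := zPerm_le_zPerm_mul_swap (α⁻¹ * θ * swap b d) hac
  rw [hmul] at hlower₂
  have hsign : sign (α⁻¹ * finRotate n) = sign (α⁻¹ * θ) := by
    simp [← hmul, sign_swap hbd, sign_swap hac]
  rw [sign_eq_neg_one_pow_zPerm, sign_eq_neg_one_pow_zPerm] at hsign
  have hparity : Even (n + zPerm (α⁻¹ * finRotate n)) ↔ Even (n + zPerm (α⁻¹ * θ)) := by
    rw [← neg_one_pow_eq_one_iff_even (R := ℤˣ) (by decide), hsign,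
      neg_one_pow_eq_one_iff_even (by decide)]
  simp only [Nat.even_iff] at hparity
  omega
end

section
/- For any permutation α of {1,…,n} of genus 1 (i.e., z(α) + z(α⁻¹ ∘ ζ_n) = n − 1), there exist integers 1 ≤ a < b ≤ c < d ≤ n such that the permutation θ = ζ_n ∘ (a c) ∘ (b d) satisfies z(α) + z(α⁻¹ ∘ θ) = n + 1; that is, every genus-1 permutation admits a sequence of separating points. -/
namespace Equiv.Perm

section SwapSplitting

variable {ι : Type*} {f : Perm ι} {x y u v : ι}

theorem SameCycle.rel_of_forall_rel_apply (s : Setoid ι) (hs : ∀ w, s w (f w))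
    (h : f.SameCycle u v) : s u v := by
  obtain ⟨k, rfl⟩ := h
  induction k with
  | zero => exact s.refl _
  | succ k ih =>
    rw [add_comm, zpow_one_add]
    exact s.trans ih (hs _)
  | pred k ih =>
    refine s.trans ih (s.symm ?_)
    have h := hs ((f ^ (-(k : ℤ) - 1)) u)
    rwa [← mul_apply, ← zpow_one_add, add_sub_cancel] at h

theorem SameCycle.not_sameCycle_mul_swap [Finite ι] [DecidableEq ι] (hxy : x ≠ y)
    (h : f.SameCycle x y) : ¬ (f * swap x y).SameCycle x y := by
  have hex : ∃ k : ℕ, (f ^ k) x = y := h.exists_nat_pow_eq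
  set k := Nat.find hex
  have hky : (f ^ k) x = y := Nat.find_spec hex
  have hmin : ∀ m < k, (f ^ m) x ≠ y := fun m hm => Nat.find_min hex hm
  have hnx : ∀ m, 1 ≤ m → m ≤ k → (f ^ m) x ≠ x := by
    intro m h1 hmk hm
    apply hmin (k - m) (by omega)
    have : (f ^ (k - m)) ((f ^ m) x) = y := by
      rw [← mul_apply, ← pow_add, Nat.sub_add_cancel hmk, hky]
    rwa [hm] at this
  have hk0 : 1 ≤ k := by
    rcases Nat.eq_zero_or_pos k with h0 | h0
    · rw [h0] at hky
      exact absurd hky hxy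
    · exact h0
  have hinv : ∀ j : ℕ, ∃ m, 1 ≤ m ∧ m ≤ k ∧ ((f * swap x y) ^ j) y = (f ^ m) x := by
    intro j
    induction j with
    | zero => exact ⟨k, hk0, le_rfl, hky.symm⟩
    | succ j ih =>
      obtain ⟨m, h1, hmk, hm⟩ := ih
      rw [pow_succ', mul_apply, hm]
      rcases hmk.eq_or_lt with rfl | hlt
      · exact ⟨1, le_rfl, hk0, by rw [hky]; simp⟩
      · refine ⟨m + 1, by omega, hlt, ?_⟩
        rw [mul_apply, swap_apply_of_ne_of_ne (hnx m h1 hmk) (hmin m hlt), pow_succ', mul_apply]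
  intro hg
  obtain ⟨j, hj⟩ := hg.symm.exists_nat_pow_eq
  obtain ⟨m, h1, hmk, hm⟩ := hinv j
  exact hnx m h1 hmk (hm.symm.trans hj)

theorem sameCycle_mul_swap_of_not_sameCycle [Finite ι] [DecidableEq ι]
    (h : ¬ f.SameCycle x y) : (f * swap x y).SameCycle x y := by
  by_contra hg
  have key : ∀ j : ℕ, (f * swap x y).SameCycle y ((f ^ (j + 1)) x) := by
    intro j
    induction j with
    | zero => exact ⟨1, by simp⟩
    | succ j ih =>
      have hy : (f ^ (j + 1)) x ≠ y := fun hy => h ⟨(j + 1 : ℕ), by rwa [zpow_natCast]⟩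
      have hx : (f ^ (j + 1)) x ≠ x := fun hx => hg (by rw [hx] at ih; exact ih.symm)
      have : (f ^ (j + 1 + 1)) x = (f * swap x y) ((f ^ (j + 1)) x) := by
        rw [mul_apply, swap_apply_of_ne_of_ne hx hy, pow_succ' f (j + 1), mul_apply]
      rw [this]
      exact sameCycle_apply_right.2 ih
  have := key (orderOf f - 1)
  rw [Nat.sub_add_cancel (orderOf_pos f), pow_orderOf_eq_one] at this
  exact hg this.symm

theorem SameCycle.mul_swap [DecidableEq ι] (hxy : (f * swap x y).SameCycle x y)
    (huv : f.SameCycle u v) : (f * swap x y).SameCycle u v := by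
  refine huv.rel_of_forall_rel_apply (SameCycle.setoid (f * swap x y)) fun w => ?_
  change (f * swap x y).SameCycle w (f w)
  by_cases hx : w = x
  · subst hx
    exact hxy.trans ⟨1, by simp⟩
  by_cases hy : w = y
  · subst hy
    exact hxy.symm.trans ⟨1, by simp⟩
  exact ⟨1, by simp [swap_apply_of_ne_of_ne hx hy]⟩

end SwapSplitting

end Equiv.Perm

open Equiv Equiv.Perm

section CycleCount

variable {n : ℕ} {f : Perm (Fin n)} {x y : Fin n}

theorem zPerm_one : zPerm (1 : Perm (Fin n)) = n := by
  have h : Function.Bijective (Quotient.mk (cycleSetoid (1 : Perm (Fin n)))) := by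
    refine ⟨fun u v huv => ?_, Quotient.mk_surjective⟩
    exact sameCycle_one.1 (Quotient.exact huv)
  rw [zPerm, ← Nat.card_eq_of_bijective _ h, Nat.card_fin]

theorem zPerm_conj_s12 (f g : Perm (Fin n)) : zPerm (g * f * g⁻¹) = zPerm f :=
  Nat.card_congr (Quotient.congr g⁻¹ fun _ _ => sameCycle_conj)

/-- Multiplying by a transposition of points in different cycles merges these cycles. -/
theorem zPerm_eq_of_not_sameCycle (h : ¬ f.SameCycle x y) :
    zPerm f = zPerm (f * swap x y) + 1 := by
  classical
  have hxy := sameCycle_mul_swap_of_not_sameCycle h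
  set g := f * swap x y with hg
  let mk : Fin n → Quotient (cycleSetoid f) := Quotient.mk _
  have mk_eq : ∀ {u v}, mk u = mk v ↔ f.SameCycle u v := Quotient.eq (r := cycleSetoid f)
  let c : Fin n → Quotient (cycleSetoid f) := fun u => if mk u = mk y then mk x else mk u
  have hc : ∀ w, c w = c (g w) := by
    have mk_apply : ∀ w, mk (f w) = mk w := fun w => mk_eq.2 ⟨-1, by simp⟩
    have hne : mk x ≠ mk y := fun e => h (mk_eq.1 e)
    intro w
    by_cases hx : w = x
    · subst hx
      simp [c, hg, mk_apply]
    by_cases hy : w = y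
    · subst hy
      simp [c, hg, mk_apply]
    simp [c, hg, mk_apply, swap_apply_of_ne_of_ne hx hy]
  have hcg : ∀ u v, g.SameCycle u v → c u = c v := fun u v huv =>
    huv.rel_of_forall_rel_apply (Setoid.ker c) hc
  have hgc : ∀ u v, c u = c v → g.SameCycle u v := by
    intro u v huv
    by_cases hu : mk u = mk y <;> by_cases hv : mk v = mk y <;>
      simp only [c, hu, hv, if_true, if_false] at huv
    · exact (hxy.mul_swap (mk_eq.1 hu)).trans (hxy.mul_swap (mk_eq.1 hv)).symm
    · exact ((hxy.mul_swap (mk_eq.1 hu)).trans hxy.symm).trans (hxy.mul_swap (mk_eq.1 huv))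
    · exact ((hxy.mul_swap (mk_eq.1 huv)).trans hxy).trans (hxy.mul_swap (mk_eq.1 hv)).symm
    · exact hxy.mul_swap (mk_eq.1 huv)
  have hcy : ∀ u, c u ≠ mk y := by
    intro u hu
    by_cases hu' : mk u = mk y
    · simp only [c, hu', if_true] at hu
      exact h (mk_eq.1 hu)
    · simp only [c, hu', if_false] at hu
  let F : Option (Quotient (cycleSetoid g)) → Quotient (cycleSetoid f) :=
    fun o => o.elim (mk y) (Quotient.lift c hcg)
  have hF : Function.Bijective F := by
    constructor
    · rintro (_ | p) (_ | q) hpq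
      · rfl
      · induction q using Quotient.ind
        exact absurd hpq.symm (hcy _)
      · induction p using Quotient.ind
        exact absurd hpq (hcy _)
      · induction p using Quotient.ind
        induction q using Quotient.ind
        exact congrArg some (Quotient.sound (hgc _ _ hpq))
    · intro q
      induction q using Quotient.ind with | _ u
      by_cases hu : mk u = mk y
      · exact ⟨none, hu.symm⟩
      · exact ⟨some (Quotient.mk _ u), if_neg hu⟩
  rw [zPerm, ← Nat.card_eq_of_bijective F hF, Finite.card_option, zPerm]

/-- Multiplying by a transposition of two points of the same cycle splits it. -/
theorem zPerm_mul_swap_of_sameCycle (hxy : x ≠ y) (h : f.SameCycle x y) :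
    zPerm (f * swap x y) = zPerm f + 1 := by
  rw [zPerm_eq_of_not_sameCycle (h.not_sameCycle_mul_swap hxy), mul_swap_mul_self]

theorem zPerm_mul_swap_le (f : Perm (Fin n)) (x y : Fin n) :
    zPerm (f * swap x y) ≤ zPerm f + 1 := by
  by_cases hxy : x = y
  · rw [hxy, swap_self, ← Perm.one_def, mul_one]
    exact Nat.le_succ _
  by_cases h : f.SameCycle x y
  · exact (zPerm_mul_swap_of_sameCycle hxy h).le
  · have := zPerm_eq_of_not_sameCycle h
    omega

theorem zPerm_swap_mul_le (f : Perm (Fin n)) (x y : Fin n) :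
    zPerm (swap x y * f) ≤ zPerm f + 1 := by
  rw [swap_mul_eq_mul_swap]
  exact zPerm_mul_swap_le _ _ _

theorem zPerm_le_swap_mul (f : Perm (Fin n)) (x y : Fin n) :
    zPerm f ≤ zPerm (swap x y * f) + 1 := by
  simpa using zPerm_swap_mul_le (swap x y * f) x y

end CycleCount

section SeparatingPoints

variable {n : ℕ} {β ζ : Perm (Fin n)} {S : Finset (Fin n)}

/-- No product of `β` with a pair of transpositions `(a c)`, `(b d)`, where `a < b ≤ c < d`,
has two more cycles than `β`. -/
def NoSeparatingPoints (β : Perm (Fin n)) : Prop :=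
  ∀ a b c d : Fin n, a < b → b ≤ c → c < d →
    zPerm (β * swap a c * swap b d) < zPerm β + 2

/-- `ζ` fixes every point outside `S` and sends every non-maximal element of `S` to the next one. -/
structure IsIncreasingCycleOn (ζ : Perm (Fin n)) (S : Finset (Fin n)) : Prop where
  apply_of_notMem : ∀ i ∉ S, ζ i = i
  isLeast_apply : ∀ i ∈ S, ∀ j ∈ S, i < j → IsLeast {k | k ∈ S ∧ i < k} (ζ i)

theorem IsIncreasingCycleOn.erase (h : IsIncreasingCycleOn ζ S) {i : Fin n} (hi : i ∈ S) :
    IsIncreasingCycleOn (swap i (ζ i) * ζ) (S.erase i) := by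
  constructor
  · intro w hw
    by_cases hwi : w = i
    · subst hwi
      simp
    have hwS : w ∉ S := fun hwS => hw (Finset.mem_erase.2 ⟨hwi, hwS⟩)
    have hζw := h.apply_of_notMem w hwS
    have hne : w ≠ ζ i := fun e => hwi (ζ.injective (hζw.trans e))
    rw [mul_apply, hζw, swap_apply_of_ne_of_ne hwi hne]
  · intro u hu v hv huv
    obtain ⟨hui, huS⟩ := Finset.mem_erase.1 hu
    obtain ⟨hvi, hvS⟩ := Finset.mem_erase.1 hv
    obtain ⟨⟨hζuS, hζu⟩, hmin⟩ := h.isLeast_apply u huS v hvS huv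
    rw [mul_apply]
    by_cases hζui : ζ u = i
    · rw [hζui, swap_apply_left]
      have hiv : i < v := lt_of_le_of_ne (hζui ▸ hmin ⟨hvS, huv⟩) (Ne.symm hvi)
      obtain ⟨⟨hζiS, hζi⟩, hmin'⟩ := h.isLeast_apply i hi v hvS hiv
      refine ⟨⟨Finset.mem_erase.2 ⟨hζi.ne', hζiS⟩, (hζui ▸ hζu).trans hζi⟩, ?_⟩
      rintro k ⟨hk, huk⟩
      obtain ⟨hki, hkS⟩ := Finset.mem_erase.1 hk
      exact hmin' ⟨hkS, lt_of_le_of_ne (hζui ▸ hmin ⟨hkS, huk⟩) (Ne.symm hki)⟩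
    · rw [swap_apply_of_ne_of_ne hζui (fun e => hui (ζ.injective e))]
      refine ⟨⟨Finset.mem_erase.2 ⟨hζui, hζuS⟩, hζu⟩, ?_⟩
      rintro k ⟨hk, huk⟩
      exact hmin ⟨Finset.mem_of_mem_erase hk, huk⟩

/-- A point `k` strictly between `i` and `β i` is sent strictly between these points. -/
theorem NoSeparatingPoints.apply_mem_Ioo (hβ : NoSeparatingPoints β) {i k : Fin n} (hik : i < k)
    (hkj : k < β i) : i < β k ∧ β k < β i := by
  have hsame : ¬ β.SameCycle i k := by
    intro h
    have h1 := zPerm_mul_swap_of_sameCycle hik.ne h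
    have h2 := zPerm_mul_swap_of_sameCycle (f := β * swap i k) hkj.ne ⟨1, by simp⟩
    have := hβ i k k (β i) hik le_rfl hkj
    omega
  have hne : β k ≠ i := fun e => hsame (SameCycle.symm ⟨1, by simpa using e⟩)
  have hne' : β k ≠ β i := fun e => hik.ne' (β.injective e)
  constructor
  · by_contra hlt
    have hlt : β k < i := lt_of_le_of_ne (not_lt.1 hlt) hne
    have h1 := zPerm_mul_swap_of_sameCycle (f := β) (hlt.trans hik).ne
      (SameCycle.symm ⟨1, by simp⟩)
    have h2 := zPerm_mul_swap_of_sameCycle (f := β * swap (β k) k) (hik.trans hkj).ne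
      ⟨1, by simp [swap_apply_of_ne_of_ne hne.symm hik.ne]⟩
    have := hβ (β k) i k (β i) hlt hik.le hkj
    omega
  · by_contra hlt
    have hlt : β i < β k := lt_of_le_of_ne (not_lt.1 hlt) hne'.symm
    have h1 := zPerm_mul_swap_of_sameCycle (f := β) (hik.trans hkj).ne ⟨1, by simp⟩
    have h2 := zPerm_mul_swap_of_sameCycle (f := β * swap i (β i)) (hkj.trans hlt).ne
      ⟨1, by simp [swap_apply_of_ne_of_ne hik.ne' hkj.ne]⟩
    have := hβ i k (β i) (β k) hik hkj.le hlt
    omega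

theorem mem_of_apply_mem_of_fixes_compl (hβS : ∀ i ∉ S, β i = i) {i : Fin n} (hi : i ∈ S) :
    β i ∈ S := by
  by_contra h
  exact h (by rwa [β.injective (hβS _ h)])

theorem NoSeparatingPoints.exists_apply_eq_of_lt (hβ : NoSeparatingPoints β)
    (hβS : ∀ i ∉ S, β i = i) (hζ : IsIncreasingCycleOn ζ S) (m : ℕ) {i : Fin n} (hi : i ∈ S)
    (hlt : i < β i) (hm : (β i : ℕ) - i ≤ m) : ∃ k ∈ S, β k = k ∨ β k = ζ k := by
  induction m generalizing i with
  | zero => exact absurd hlt (by rw [Fin.lt_def]; omega)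
  | succ m ih =>
    have hβi : β i ∈ S := mem_of_apply_mem_of_fixes_compl hβS hi
    obtain ⟨⟨hζS, hζi⟩, hmin⟩ := hζ.isLeast_apply i hi _ hβi hlt
    rcases (hmin ⟨hβi, hlt⟩ : ζ i ≤ β i).eq_or_lt with heq | hlt'
    · exact ⟨i, hi, Or.inr heq.symm⟩
    by_cases hfix : β (ζ i) = ζ i
    · exact ⟨_, hζS, Or.inl hfix⟩
    obtain ⟨h1, h2⟩ := hβ.apply_mem_Ioo hζi hlt'
    have hβζ : β (ζ i) ∈ S := mem_of_apply_mem_of_fixes_compl hβS hζS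
    have h3 : ζ i < β (ζ i) := lt_of_le_of_ne (hmin ⟨hβζ, h1⟩) (Ne.symm hfix)
    refine ih hζS h3 ?_
    rw [Fin.lt_def] at *
    omega

theorem NoSeparatingPoints.exists_apply_eq (hβ : NoSeparatingPoints β)
    (hβS : ∀ i ∉ S, β i = i) (hζ : IsIncreasingCycleOn ζ S) (hS : S.Nonempty) :
    ∃ k ∈ S, β k = k ∨ β k = ζ k := by
  have hmem := mem_of_apply_mem_of_fixes_compl hβS (S.min'_mem hS)
  rcases (S.min'_le _ hmem).eq_or_lt with heq | hlt
  · exact ⟨_, S.min'_mem hS, Or.inl heq.symm⟩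
  · exact hβ.exists_apply_eq_of_lt hβS hζ _ (S.min'_mem hS) hlt le_rfl

/-- If `β` has no separating points, then it has genus zero with respect to `ζ`. -/
theorem NoSeparatingPoints.le_zPerm_add_zPerm (hβ : NoSeparatingPoints β)
    (hβS : ∀ i ∉ S, β i = i) (hζ : IsIncreasingCycleOn ζ S) (hS : S.Nonempty) :
    2 * n + 1 ≤ zPerm β + zPerm (β⁻¹ * ζ) + S.card := by
  obtain ⟨m, hm⟩ : ∃ m, S.card = m + 1 := Nat.exists_eq_succ_of_ne_zero hS.card_pos.ne'
  induction m generalizing S β ζ with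
  | zero =>
    obtain ⟨s, rfl⟩ := Finset.card_eq_one.1 hm
    have eq_one : ∀ γ : Perm (Fin n), (∀ i ∉ ({s} : Finset (Fin n)), γ i = i) → γ = 1 := by
      intro γ hγ
      ext i : 1
      by_cases hi : i ∈ ({s} : Finset (Fin n))
      · have h := mem_of_apply_mem_of_fixes_compl hγ hi
        rw [Finset.mem_singleton] at h hi
        rw [h, hi, one_apply]
      · exact hγ i hi
    rw [eq_one β hβS, eq_one ζ hζ.apply_of_notMem, inv_one, one_mul, zPerm_one,
      Finset.card_singleton]
    omega
  | succ m ih =>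
    obtain ⟨i, hi, hβi⟩ := hβ.exists_apply_eq hβS hζ hS
    have hcard : (S.erase i).card = m + 1 := by rw [Finset.card_erase_of_mem hi, hm]; rfl
    have hS' : (S.erase i).Nonempty := Finset.card_pos.1 (by omega)
    have hζ' := hζ.erase hi
    by_cases hfix : β i = i
    · have hβS' : ∀ w ∉ S.erase i, β w = w := by
        intro w hw
        by_cases hwi : w = i
        · rw [hwi, hfix]
        · exact hβS w fun hwS => hw (Finset.mem_erase.2 ⟨hwi, hwS⟩)
      have h1 := ih hβ hβS' hζ' hS' hcard
      have h2 : zPerm (β⁻¹ * (swap i (ζ i) * ζ)) ≤ zPerm (β⁻¹ * ζ) + 1 := by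
        rw [← mul_assoc, mul_swap_eq_swap_mul, mul_assoc]
        exact zPerm_swap_mul_le _ _ _
      omega
    · have hβζ : β i = ζ i := hβi.resolve_left hfix
      have hsplit : zPerm (swap i (ζ i) * β) = zPerm β + 1 := by
        rw [swap_mul_eq_mul_swap, ← hβζ, ← mul_apply, inv_mul_cancel, one_apply]
        refine zPerm_mul_swap_of_sameCycle (fun e => hfix ?_) ⟨1, by simp⟩
        exact (inv_eq_iff_eq.1 e).symm
      have hβ' : NoSeparatingPoints (swap i (ζ i) * β) := by
        intro a b c d hab hbc hcd
        have h1 := hβ a b c d hab hbc hcd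
        have h2 := zPerm_swap_mul_le (β * swap a c * swap b d) i (ζ i)
        simp only [mul_assoc] at h1 h2 hsplit ⊢
        omega
      have hβS' : ∀ w ∉ S.erase i, (swap i (ζ i) * β) w = w := by
        intro w hw
        by_cases hwi : w = i
        · rw [hwi, mul_apply, hβζ, swap_apply_right]
        have hβw := hβS w fun hwS => hw (Finset.mem_erase.2 ⟨hwi, hwS⟩)
        have hne : w ≠ ζ i := fun e => hwi (β.injective (by rw [hβw, hβζ, e]))
        rw [mul_apply, hβw, swap_apply_of_ne_of_ne hwi hne]
      have h1 := ih hβ' hβS' hζ' hS' hcard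
      rw [mul_inv_rev, swap_inv, mul_assoc, swap_mul_self_mul] at h1
      omega

theorem isIncreasingCycleOn_finRotate (n : ℕ) :
    IsIncreasingCycleOn (finRotate n) Finset.univ := by
  refine ⟨fun i hi => absurd (Finset.mem_univ i) hi, fun i _ j _ hij => ?_⟩
  obtain ⟨i, hi⟩ := i
  obtain ⟨j, hj⟩ := j
  obtain ⟨n, rfl⟩ : ∃ m, n = m + 1 := ⟨n - 1, by omega⟩
  rw [Fin.mk_lt_mk] at hij
  rw [finRotate_of_lt (by omega)]
  refine ⟨⟨Finset.mem_univ _, Nat.lt_succ_self i⟩, ?_⟩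
  rintro k ⟨-, hk⟩
  exact hk

end SeparatingPoints

/-- Every genus-one permutation of `{1,…,n}` admits a sequence of separating points:
points `a < b ≤ c < d` such that `θ = ζₙ ∘ (a c) ∘ (b d)` satisfies
`z(α) + z(α⁻¹ ∘ θ) = n + 1`, i.e. the hypermap `(θ, α)` has genus 0. -/
theorem exists_separating_points (n : ℕ) (α : Equiv.Perm (Fin n)) (h : IsGenusOne α) :
    ∃ a b c d : Fin n, a < b ∧ b ≤ c ∧ c < d ∧
      zPerm α +
          zPerm (α⁻¹ * (finRotate n * Equiv.swap a c * Equiv.swap b d)) = n + 1 := by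
  by_contra hno
  have hα : zPerm ((α⁻¹ * finRotate n)⁻¹ * finRotate n) = zPerm α := by
    rw [← zPerm_conj_s12 α (finRotate n)⁻¹, mul_inv_rev, inv_inv, inv_inv]
  have h' : zPerm α + zPerm (α⁻¹ * finRotate n) + 2 = n + 1 := h
  have hβ : NoSeparatingPoints (α⁻¹ * finRotate n) := by
    intro a b c d hab hbc hcd
    by_contra hge
    refine hno ⟨a, b, c, d, hab, hbc, hcd, ?_⟩
    have h1 := zPerm_mul_swap_le (α⁻¹ * finRotate n) a c
    have h2 := zPerm_mul_swap_le (α⁻¹ * finRotate n * swap a c) b d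
    simp only [mul_assoc] at h1 h2 hge h' ⊢
    omega
  have hn : 0 < n := by omega
  have : (Finset.univ : Finset (Fin n)).Nonempty := ⟨⟨0, hn⟩, Finset.mem_univ _⟩
  have := hβ.le_zPerm_add_zPerm (fun i hi => absurd (Finset.mem_univ i) hi)
    (isIncreasingCycleOn_finRotate n) this
  rw [hα, Finset.card_univ, Fintype.card_fin] at this
  omega
end

section
/- Let α be a reduced permutation of {1,…,n} of genus 1. Then: (i) there exists a smallest element a with α(a) ≠ a+1; (ii) there exists a smallest element b with b > a such that α(b) > α(a) or α(b) ≤ a; and (iii) setting c = α(a) − 1, and d = n if α(b) = 1 and d = α(b) − 1 otherwise, the quadruple (a,b,c,d) satisfies 1 ≤ a < b ≤ c < d ≤ n and z(α) + z(α⁻¹ ∘ ζ_n ∘ (a c) ∘ (b d)) = n + 1, i.e., (a,b,c,d) is a sequence of separating points for α. -/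
/-- The points `i, ζ i, …, ζᵖ i` (where `ζ = finRotate n`) form a trivial cycle of `α`:
a cycle consisting of cyclically consecutive points, each sent to the cyclically next
one, the last back to the first. -/
def IsTrivialCycleAt {n : ℕ} (α : Equiv.Perm (Fin n)) (i : Fin n) (p : ℕ) : Prop :=
  p < n ∧ (∀ t : ℕ, t < p → α ((finRotate n ^ t) i) = (finRotate n ^ (t + 1)) i) ∧
    α ((finRotate n ^ p) i) = i

/-- `α` is reduced: it contains no trivial cycle. -/
def IsReducedPerm {n : ℕ} (α : Equiv.Perm (Fin n)) : Prop :=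
  ¬ ∃ (i : Fin n) (p : ℕ), IsTrivialCycleAt α i p

theorem apply_eq_of_sameCycle_s16 {X Q : Type*} {β : Equiv.Perm X} {f : X → Q}
    (hf : ∀ x, f (β x) = f x) {x y : X} (h : β.SameCycle x y) : f x = f y := by
  obtain ⟨i, rfl⟩ := h
  induction i with
  | zero => simp
  | succ i ih => rw [add_comm, zpow_add, zpow_one, Equiv.Perm.mul_apply, hf, ih]
  | pred i ih =>
    rw [ih, ← hf ((β ^ (-(i : ℤ) - 1)) x), ← Equiv.Perm.mul_apply, ← zpow_one_add]
    congr 3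
    ring

theorem zPerm_mul_swap_s16 {n : ℕ} {β : Equiv.Perm (Fin n)} {u v : Fin n} (huv : u ≠ v)
    (hβ : β v = u) : zPerm (β * Equiv.swap u v) = zPerm β + 1 := by
  set γ := β * Equiv.swap u v with hγ
  have γu : γ u = u := by simp [hγ, hβ]
  have γv : γ v = β u := by simp [hγ]
  have γx : ∀ x, x ≠ u → x ≠ v → γ x = β x := fun x h1 h2 => by
    simp [hγ, Equiv.swap_apply_of_ne_of_ne h1 h2]
  have sub : ∀ {x y}, γ.SameCycle x y → β.SameCycle x y := by
    intro x y h
    have key : ∀ x, (Quotient.mk (cycleSetoid β) (γ x)) = Quotient.mk (cycleSetoid β) x := by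
      intro x
      apply Quotient.sound
      change β.SameCycle _ _
      rcases eq_or_ne x u with rfl | h1
      · rw [γu]
      rcases eq_or_ne x v with rfl | h2
      · rw [γv, ← hβ]
        simp [Equiv.Perm.SameCycle.refl]
      · rw [γx x h1 h2]
        simp [Equiv.Perm.SameCycle.refl]
    exact Quotient.exact (apply_eq_of_sameCycle_s16 key h)
  let r : Fin n → Fin n := fun x => if x = u then v else x
  have ru : ∀ x, r x ≠ u := by
    intro x
    by_cases h : x = u <;> simp [r, h, huv.symm]
  have rβ : ∀ x, β.SameCycle x (r x) := by
    intro x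
    by_cases h : x = u
    · subst h
      simp only [r, if_true]
      nth_rewrite 1 [← hβ]
      simp [Equiv.Perm.SameCycle.refl]
    · simp [r, h, Equiv.Perm.SameCycle.refl]
  have step : ∀ x, Quotient.mk (cycleSetoid γ) (r (β x)) = Quotient.mk (cycleSetoid γ) (r x) := by
    intro x
    apply Quotient.sound
    change γ.SameCycle _ _
    rcases eq_or_ne x v with rfl | h2
    · simp [r, hβ, Equiv.Perm.SameCycle.refl]
    have h3 : β x ≠ u := fun h => h2 (β.injective (h.trans hβ.symm))
    rcases eq_or_ne x u with rfl | h1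
    · have : r (β x) = γ v := by simp [r, h3, γv]
      simp [this, r, Equiv.Perm.SameCycle.refl]
    · have : r (β x) = γ x := by simp [r, h3, γx x h1 h2]
      simp [this, r, h1, Equiv.Perm.SameCycle.refl]
  have fixed : ∀ {x}, γ.SameCycle x u → x = u := by
    intro x h
    exact ((Equiv.Perm.sameCycle_comm.1 h).eq_of_left γu).symm
  let F : Option (Quotient (cycleSetoid β)) → Quotient (cycleSetoid γ) := fun o =>
    o.elim (Quotient.mk _ u) (Quotient.lift (fun x => Quotient.mk (cycleSetoid γ) (r x))
      fun x y h => apply_eq_of_sameCycle_s16 (f := fun x => Quotient.mk (cycleSetoid γ) (r x)) step h)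
  have hF : Function.Bijective F := by
    constructor
    · rintro (_ | ⟨⟨x⟩⟩) (_ | ⟨⟨y⟩⟩) h
      · rfl
      · exact absurd (fixed (Quotient.exact h.symm)) (ru y)
      · exact absurd (fixed (Quotient.exact h)) (ru x)
      · have h' := sub (Quotient.exact h)
        exact congrArg some (Quotient.sound (((rβ x).trans h').trans (rβ y).symm))
    · rintro ⟨y⟩
      by_cases h : y = u
      · exact ⟨none, by subst h; rfl⟩
      · refine ⟨some (Quotient.mk _ y), ?_⟩
        change Quotient.mk (cycleSetoid γ) (r y) = Quotient.mk (cycleSetoid γ) y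
        simp [r, h]
  rw [zPerm, zPerm, ← Nat.card_congr (Equiv.ofBijective F hF), Finite.card_option]

/-- The bipartite graph joining each cycle of `α` to the cycles of `β` it meets is connected when
`α` and `β` generate a transitive group, so it has at most one vertex more than edges. -/
theorem zPerm_add_zPerm_le {n : ℕ} (hn : 0 < n) {α β : Equiv.Perm (Fin n)}
    (h : ∀ (Q : Type) (f : Fin n → Q), (∀ x, f (α x) = f x) → (∀ x, f (β x) = f x) →
      ∀ x y, f x = f y) : zPerm α + zPerm β ≤ n + 1 := by
  let V := Quotient (cycleSetoid α) ⊕ Quotient (cycleSetoid β)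
  let l : Fin n → V := fun x => Sum.inl (Quotient.mk _ x)
  let r : Fin n → V := fun x => Sum.inr (Quotient.mk _ x)
  let G : SimpleGraph V := SimpleGraph.fromEdgeSet (Set.range fun x => s(l x, r x))
  have adj : ∀ x, G.Adj (l x) (r x) := fun x => by
    rw [SimpleGraph.fromEdgeSet_adj]
    exact ⟨⟨x, rfl⟩, by simp [l, r]⟩
  have comp : ∀ x, G.connectedComponentMk (r x) = G.connectedComponentMk (l x) := fun x =>
    SimpleGraph.ConnectedComponent.sound (adj x).symm.reachable
  have lα : ∀ x, l (α x) = l x := fun x =>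
    congrArg Sum.inl (Quotient.sound (show α.SameCycle _ _ by simp [Equiv.Perm.SameCycle.refl]))
  have rβ : ∀ x, r (β x) = r x := fun x =>
    congrArg Sum.inr (Quotient.sound (show β.SameCycle _ _ by simp [Equiv.Perm.SameCycle.refl]))
  have const := h _ (fun x => G.connectedComponentMk (l x)) (fun x => by rw [lα])
    (fun x => by rw [← comp, rβ, comp])
  have hV : ∀ w : V, G.connectedComponentMk w = G.connectedComponentMk (l ⟨0, hn⟩) := by
    rintro (⟨⟨x⟩⟩ | ⟨⟨x⟩⟩)
    · exact const x _
    · exact (comp x).trans (const x _)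
  have conn : G.Connected :=
    { preconnected := fun w w' => SimpleGraph.ConnectedComponent.exact ((hV w).trans (hV w').symm)
      nonempty := ⟨l ⟨0, hn⟩⟩ }
  have h1 := conn.card_vert_le_card_edgeSet_add_one
  have h2 : Nat.card G.edgeSet ≤ n := by
    have h3 : G.edgeSet ⊆ Set.range fun x => s(l x, r x) := by
      rw [SimpleGraph.edgeSet_fromEdgeSet]
      exact Set.sdiff_subset
    calc Nat.card G.edgeSet ≤ Nat.card (Set.range fun x => s(l x, r x)) :=
          Nat.card_mono (Set.finite_range _) h3
      _ ≤ Nat.card (Fin n) := Finite.card_range_le _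
      _ = n := by simp
  have h4 : Nat.card V = zPerm α + zPerm β := Nat.card_sum
  omega

theorem finRotate_val {n : ℕ} (x : Fin n) : (finRotate n x : ℕ) = (x + 1) % n := by
  obtain _ | m := n
  · exact x.elim0
  · rw [finRotate_apply, Fin.val_add_one]
    split_ifs with h
    · simp [h]
    · rw [Nat.mod_eq_of_lt]
      have := Fin.val_lt_last h
      omega

theorem finRotate_pow_val {n : ℕ} (x : Fin n) (t : ℕ) :
    ((finRotate n ^ t) x : ℕ) = (x + t) % n := by
  induction t with
  | zero => simp [Nat.mod_eq_of_lt x.2]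
  | succ t ih => rw [pow_succ', Equiv.Perm.mul_apply, finRotate_val, ih, Nat.mod_add_mod, add_assoc]

/-- An interval mapped into itself by an injection `A` without consecutive cycles contains a
crossing of `A`. -/
theorem exists_crossing_of_mapsTo_Icc {n : ℕ} {A : ℕ → ℕ} (hA : Function.Injective A)
    (hR : ∀ p q, p ≤ q → q < n → (∀ x, p ≤ x → x < q → A x = x + 1) → A q ≠ p)
    (p q : ℕ) (hp : 1 ≤ p) (hpq : p ≤ q) (hq : q < n)
    (hs : ∀ x, p ≤ x → x ≤ q → p ≤ A x ∧ A x ≤ q) :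
    ∃ a b c d, p ≤ a ∧ a < b ∧ b ≤ c ∧ c < q ∧ A a = c + 1 ∧ A b = d + 1 ∧
      (c < d ∧ d < q ∨ p ≤ d + 1 ∧ d < a) := by
  induction hk : q - p using Nat.strong_induction_on generalizing p q with
  | _ k ih =>
  have hex : ∃ x, p ≤ x ∧ A x ≠ x + 1 := ⟨q, hpq, by have := hs q hpq le_rfl; omega⟩
  obtain ⟨a, ⟨hpa, haA⟩, hmin⟩ : ∃ a, (p ≤ a ∧ A a ≠ a + 1) ∧
      ∀ x, p ≤ x → x < a → A x = x + 1 := by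
    classical
    refine ⟨Nat.find hex, Nat.find_spec hex, fun x h1 h2 => ?_⟩
    have := Nat.find_min hex h2
    tauto
  have haq : a ≤ q := by
    by_contra hlt
    have := hmin q hpq (by omega)
    have := hs q hpq le_rfl
    omega
  have hAa := hs a hpa haq
  have notmem : ∀ x, a ≤ x → ¬ (p < A x ∧ A x ≤ a) := by
    intro x hx h
    have h1 := hmin (A x - 1) (by omega) (by omega)
    have h2 : A (A x - 1) = A x := by omega
    have := hA h2
    omega
  have h1 := hR p a hpa (by omega) hmin
  have h2 := notmem a le_rfl
  by_cases hb : ∃ b, a < b ∧ b ≤ A a - 1 ∧ ¬ (a < A b ∧ A b ≤ A a - 1)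
  · obtain ⟨b, hab, hbc, hb⟩ := hb
    have h3 := hs b (by omega) (by omega)
    have h4 := notmem b hab.le
    have h5 : A b ≠ A a := fun h => by have := hA h; omega
    exact ⟨a, b, A a - 1, A b - 1, by omega⟩
  · push Not at hb
    obtain ⟨a', b', c', d', h⟩ := ih (A a - 1 - (a + 1)) (by omega) (a + 1) (A a - 1) (by omega)
      (by omega) (by omega) (fun x hx hx' => by have := hb x (by omega) hx'; omega) rfl
    exact ⟨a', b', c', d', by omega⟩

/-- If `A` maps `(a, c]` into itself, with `A a = c + 1` and `A x = x + 1` below `a`, then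
`A` has a crossing to the right of `c`. -/
theorem exists_crossing_right {n : ℕ} {A : ℕ → ℕ} (hA : Function.Injective A)
    (hn : ∀ x, x < n → A x < n)
    (hR : ∀ p q, p ≤ q → q < n → (∀ x, p ≤ x → x < q → A x = x + 1) → A q ≠ p)
    {a c : ℕ} (hac : a < c) (hc : c + 1 < n) (ha : A a = c + 1)
    (hmin : ∀ x, x < a → A x = x + 1)
    (hs : ∀ x, a < x → x ≤ c → a < A x ∧ A x ≤ c)
    (hcyc : ¬ (A (n - 1) = 0 ∧ ∀ x, c < x → x + 1 < n → A x = x + 1)) :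
    ∃ e f h, c < e ∧ e < f ∧ f ≤ h ∧ h + 1 < n ∧ A e = h + 1 ∧ (A f ≤ e ∨ h + 1 < A f) := by
  have hsurj : ∀ y, a < y → y ≤ c → ∃ x, a < x ∧ x ≤ c ∧ A x = y := by
    intro y hy hy'
    have hmaps : Set.MapsTo A (Finset.Ioc a c) (Finset.Ioc a c) := fun x hx => by
      simp only [Finset.coe_Ioc, Set.mem_Ioc] at hx ⊢
      exact hs x hx.1 hx.2
    obtain ⟨x, hx, hxy⟩ := Finset.surjOn_of_injOn_of_card_le A hmaps hA.injOn le_rfl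
      (show y ∈ (Finset.Ioc a c : Set ℕ) by simp [hy, hy'])
    simp only [Finset.coe_Ioc, Set.mem_Ioc] at hx
    exact ⟨x, hx.1, hx.2, hxy⟩
  have hex : ∃ x, c < x ∧ A x ≠ x + 1 := ⟨n - 1, by omega, by have := hn (n - 1); omega⟩
  obtain ⟨e, ⟨hce, heA⟩, hemin⟩ : ∃ e, (c < e ∧ A e ≠ e + 1) ∧
      ∀ x, c < x → x < e → A x = x + 1 := by
    classical
    refine ⟨Nat.find hex, Nat.find_spec hex, fun x h1 h2 => ?_⟩
    have := Nat.find_min hex h2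
    tauto
  have hen : e < n := by
    by_contra hlt
    have := hemin (n - 1) (by omega) (by omega)
    have := hn (n - 1)
    omega
  have notmem : ∀ x, e ≤ x → A x = 0 ∨ e < A x := by
    intro x hx
    by_contra! h
    obtain ⟨h0, h⟩ := h
    obtain ⟨y, hy, hyx⟩ : ∃ y, y < e ∧ A y = A x := by
      rcases Nat.lt_or_ge a (A x) with h1 | h1
      · rcases Nat.lt_or_ge c (A x) with h2 | h2
        · rcases Nat.lt_or_ge (c + 1) (A x) with h3 | h3
          · exact ⟨A x - 1, by omega, by rw [hemin _ (by omega) (by omega)]; omega⟩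
          · exact ⟨a, by omega, by omega⟩
        · obtain ⟨y, -, hy, hy'⟩ := hsurj _ h1 h2
          exact ⟨y, by omega, hy'⟩
      · exact ⟨A x - 1, by omega, by rw [hmin _ (by omega)]; omega⟩
    have := hA hyx
    omega
  have main : ∀ q, e < q → q < n → (∀ x, e < x → x ≤ q → e < A x ∧ A x ≤ q) →
      ∃ e f h, c < e ∧ e < f ∧ f ≤ h ∧ h + 1 < n ∧ A e = h + 1 ∧ (A f ≤ e ∨ h + 1 < A f) := by
    intro q heq hq hst
    obtain ⟨a', b', c', d', h⟩ := exists_crossing_of_mapsTo_Icc hA hR (e + 1) q (by omega)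
      (by omega) hq (fun x h1 h2 => hst x h1 h2)
    exact ⟨a', b', c', by omega⟩
  rcases notmem e le_rfl with h0 | h0
  · rcases Nat.lt_or_ge (e + 1) n with h1 | h1
    · refine main (n - 1) (by omega) (by omega) fun x hx hx' => ?_
      have h2 : A x ≠ A e := fun h => by have := hA h; omega
      have := notmem x hx.le
      have := hn x (by omega)
      omega
    · obtain rfl : e = n - 1 := by omega
      exact absurd ⟨h0, fun x h2 h3 => hemin x h2 (by omega)⟩ hcyc
  · have hlt := hn e hen
    by_cases hf : ∃ f, e < f ∧ f ≤ A e - 1 ∧ ¬ (e < A f ∧ A f ≤ A e - 1)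
    · obtain ⟨f, h1, h2, h3⟩ := hf
      have h5 : A f ≠ A e := fun h => by have := hA h; omega
      exact ⟨e, f, A e - 1, by omega⟩
    · push Not at hf
      exact main (A e - 1) (by omega) (by omega) hf

theorem eq_of_forall_succ_eq {Q : Type*} {φ : ℕ → Q} {l r : ℕ}
    (h : ∀ i, l ≤ i → i < r → φ (i + 1) = φ i) {i : ℕ} (hl : l ≤ i) (hr : i ≤ r) :
    φ i = φ r := by
  induction r, hr using Nat.le_induction with
  | base => rfl
  | succ r hr ih => rw [ih fun j h1 h2 => h j h1 (by omega), h r (by omega) (by omega)]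

theorem forall_eq_of_crossings {Q : Type*} {φ : ℕ → Q} {n a b c d e f h y : ℕ}
    (hab : a < b) (hbc : b ≤ c) (hd : c < d ∧ d < e ∨ d < a) (hce : c < e) (hef : e < f)
    (hfh : f ≤ h) (hn : h + 1 < n) (hy : y ≤ e ∨ h + 1 < y) (hyn : y < n)
    (gen : ∀ i, i < n → i ≠ a → i ≠ b → i ≠ c → i ≠ d → i ≠ e → i ≠ h → φ (i + 1) = φ i)
    (h0 : φ n = φ 0) (hb : b ≠ c → φ (b + 1) = φ d) (hc : φ (c + 1) = φ a) (hdb : φ (d + 1) = φ b)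
    (he : φ (e + 1) = φ h) (hhe : φ (h + 1) = φ e) (hfy : φ f = φ y) :
    ∀ i, i < n → φ i = φ 0 := by
  have hh : ∀ i, h + 1 ≤ i → i ≤ n → φ i = φ n := fun i h1 h2 =>
    eq_of_forall_succ_eq (l := h + 1) (fun j _ _ => gen j (by omega) (by omega) (by omega)
      (by omega) (by omega) (by omega) (by omega)) h1 h2
  have hee : ∀ i, e + 1 ≤ i → i ≤ h → φ i = φ h := fun i h1 h2 =>
    eq_of_forall_succ_eq (l := e + 1) (fun j _ _ => gen j (by omega) (by omega) (by omega)
      (by omega) (by omega) (by omega) (by omega)) h1 h2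
  have hbb : ∀ i, b + 1 ≤ i → i ≤ c → φ i = φ c := fun i h1 h2 =>
    eq_of_forall_succ_eq (l := b + 1) (fun j _ _ => gen j (by omega) (by omega) (by omega)
      (by omega) (by omega) (by omega) (by omega)) h1 h2
  have haa : ∀ i, a + 1 ≤ i → i ≤ b → φ i = φ b := fun i h1 h2 =>
    eq_of_forall_succ_eq (l := a + 1) (fun j _ _ => gen j (by omega) (by omega) (by omega)
      (by omega) (by omega) (by omega) (by omega)) h1 h2
  have low : ∀ i, i ≤ e → φ i = φ 0 := by
    rcases hd with ⟨hcd, hde⟩ | hda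
    · have h1 : ∀ i, d + 1 ≤ i → i ≤ e → φ i = φ e := fun i h1 h2 =>
        eq_of_forall_succ_eq (l := d + 1) (fun j _ _ => gen j (by omega) (by omega) (by omega)
          (by omega) (by omega) (by omega) (by omega)) h1 h2
      have h2 : ∀ i, c + 1 ≤ i → i ≤ d → φ i = φ d := fun i h1 h2 =>
        eq_of_forall_succ_eq (l := c + 1) (fun j _ _ => gen j (by omega) (by omega) (by omega)
          (by omega) (by omega) (by omega) (by omega)) h1 h2
      have h3 : ∀ i, 0 ≤ i → i ≤ a → φ i = φ a := fun i h1 h2 =>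
        eq_of_forall_succ_eq (l := 0) (fun j _ _ => gen j (by omega) (by omega) (by omega)
          (by omega) (by omega) (by omega) (by omega)) h1 h2
      grind
    · have h1 : ∀ i, c + 1 ≤ i → i ≤ e → φ i = φ e := fun i h1 h2 =>
        eq_of_forall_succ_eq (l := c + 1) (fun j _ _ => gen j (by omega) (by omega) (by omega)
          (by omega) (by omega) (by omega) (by omega)) h1 h2
      have h2 : ∀ i, d + 1 ≤ i → i ≤ a → φ i = φ a := fun i h1 h2 =>
        eq_of_forall_succ_eq (l := d + 1) (fun j _ _ => gen j (by omega) (by omega) (by omega)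
          (by omega) (by omega) (by omega) (by omega)) h1 h2
      have h3 : ∀ i, 0 ≤ i → i ≤ d → φ i = φ d := fun i h1 h2 =>
        eq_of_forall_succ_eq (l := 0) (fun j _ _ => gen j (by omega) (by omega) (by omega)
          (by omega) (by omega) (by omega) (by omega)) h1 h2
      grind
  grind

/-- A full crossing of `α` together with a further half crossing to its right costs two in
`z(α) + z(α⁻¹ ∘ ζₙ)` beyond genus one. -/
theorem zPerm_add_two_le_of_crossings {n : ℕ} {α : Equiv.Perm (Fin n)} {a b c d e f h : Fin n}
    (hab : a < b) (hbc : b ≤ c) (hd : c < d ∧ d < e ∨ d < a) (hce : c < e) (hef : e < f)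
    (hfh : f ≤ h) (ha : (α a : ℕ) = c + 1) (hb : (α b : ℕ) = d + 1) (he : (α e : ℕ) = h + 1)
    (hf : α f ≤ e ∨ (h : ℕ) + 1 < α f) :
    zPerm α + zPerm (α⁻¹ * finRotate n) + 2 ≤ n := by
  have rot : ∀ {x y : Fin n}, (α x : ℕ) = y + 1 → finRotate n y = α x := fun {x y} hxy => by
    apply Fin.ext
    rw [finRotate_val, ← hxy, Nat.mod_eq_of_lt (α x).2]
  have inv : ∀ {x y : Fin n}, (α x : ℕ) = y + 1 → (α⁻¹ * finRotate n) y = x := fun hxy => by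
    simp [rot hxy]
  have nac : a ≠ c := (hab.trans_le hbc).ne
  have nad : a ≠ d := by omega
  have nbd : b ≠ d := by omega
  have ncd : c ≠ d := by omega
  have nae : a ≠ e := by omega
  have nbe : b ≠ e := by omega
  have nce : c ≠ e := by omega
  have nde : d ≠ e := by omega
  have nah : a ≠ h := by omega
  have nbh : b ≠ h := by omega
  have nch : c ≠ h := by omega
  have ndh : d ≠ h := by omega
  have neh : e ≠ h := by omega
  have z1 := zPerm_mul_swap_s16 nac (inv ha)
  have z2 := zPerm_mul_swap_s16 (β := α⁻¹ * finRotate n * Equiv.swap a c) nbd (by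
    rw [Equiv.Perm.mul_apply, Equiv.swap_apply_of_ne_of_ne nad.symm ncd.symm, inv hb])
  have z3 := zPerm_mul_swap_s16 (β := α⁻¹ * finRotate n * Equiv.swap a c * Equiv.swap b d) neh (by
    rw [Equiv.Perm.mul_apply, Equiv.swap_apply_of_ne_of_ne nbh.symm ndh.symm,
      Equiv.Perm.mul_apply, Equiv.swap_apply_of_ne_of_ne nah.symm nch.symm, inv he])
  have key := zPerm_add_zPerm_le (α := α) (β := α⁻¹ * finRotate n * Equiv.swap a c *
    Equiv.swap b d * Equiv.swap e h) a.pos (by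
    intro Q g gα gβ
    have gζ : ∀ y, g (finRotate n y) =
        g (Equiv.swap e h (Equiv.swap b d (Equiv.swap a c y))) := fun y => by
      have := gβ (Equiv.swap e h (Equiv.swap b d (Equiv.swap a c y)))
      rw [← gα] at this
      simpa using this
    let φ : ℕ → Q := fun i => if hi : i < n then g ⟨i, hi⟩ else g ⟨0, a.pos⟩
    have φv : ∀ y : Fin n, φ y = g y := fun y => by simp [φ]
    have φs : ∀ y : Fin n, φ (y + 1) = g (finRotate n y) := fun y => by
      by_cases hy : (y : ℕ) + 1 < n
      · simp only [φ, hy, dif_pos]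
        congr 1
        apply Fin.ext
        rw [finRotate_val, Nat.mod_eq_of_lt hy]
      · simp only [φ, hy, dif_neg, not_false_eq_true]
        congr 1
        apply Fin.ext
        rw [finRotate_val, show (y : ℕ) + 1 = n by omega, Nat.mod_self]
    have hh := (α e).2
    have all : ∀ i, i < n → φ i = φ 0 := by
      refine forall_eq_of_crossings (a := a) (b := b) (c := c) (d := d) (e := e) (f := f)
        (h := h) (y := α f) hab hbc hd hce hef hfh (by omega) hf (α f).2 ?_ ?_ ?_ ?_ ?_ ?_ ?_ ?_
      · intro i hi h1 h2 h3 h4 h5 h6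
        have hne : ∀ x : Fin n, i ≠ x → (⟨i, hi⟩ : Fin n) ≠ x := fun x hx hx' => hx (by simp [← hx'])
        refine (φs ⟨i, hi⟩).trans ((gζ _).trans ?_)
        rw [Equiv.swap_apply_of_ne_of_ne (hne _ h1) (hne _ h3),
          Equiv.swap_apply_of_ne_of_ne (hne _ h2) (hne _ h4),
          Equiv.swap_apply_of_ne_of_ne (hne _ h5) (hne _ h6), ← φv]
      · simp [φ, a.pos]
      · intro hbc'
        rw [φs, gζ, Equiv.swap_apply_of_ne_of_ne hab.ne' (by omega), Equiv.swap_apply_left,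
          Equiv.swap_apply_of_ne_of_ne nde ndh, φv]
      · rw [φs, gζ, Equiv.swap_apply_right, Equiv.swap_apply_of_ne_of_ne hab.ne nad,
          Equiv.swap_apply_of_ne_of_ne nae nah, φv]
      · rw [φs, gζ, Equiv.swap_apply_of_ne_of_ne nad.symm ncd.symm, Equiv.swap_apply_right,
          Equiv.swap_apply_of_ne_of_ne nbe nbh, φv]
      · rw [φs, gζ, Equiv.swap_apply_of_ne_of_ne nae.symm nce.symm,
          Equiv.swap_apply_of_ne_of_ne nbe.symm nde.symm, Equiv.swap_apply_left, φv]
      · rw [φs, gζ, Equiv.swap_apply_of_ne_of_ne nah.symm nch.symm,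
          Equiv.swap_apply_of_ne_of_ne nbh.symm ndh.symm, Equiv.swap_apply_right, φv]
      · rw [φv, φv, gα]
    intro x y
    rw [← φv x, ← φv y, all x x.2, all y y.2])
  omega

/-- A permutation of `Fin n`, extended to `ℕ` by the identity. -/
def extendNat {n : ℕ} (α : Equiv.Perm (Fin n)) (i : ℕ) : ℕ :=
  if h : i < n then α ⟨i, h⟩ else i

theorem extendNat_val {n : ℕ} (α : Equiv.Perm (Fin n)) (x : Fin n) :
    extendNat α x = α x := by
  simp [extendNat]

theorem extendNat_lt {n : ℕ} (α : Equiv.Perm (Fin n)) {i : ℕ} (h : i < n) :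
    extendNat α i < n := by
  simp [extendNat, h]

theorem extendNat_injective {n : ℕ} (α : Equiv.Perm (Fin n)) :
    Function.Injective (extendNat α) := by
  intro i j h
  by_cases hi : i < n <;> by_cases hj : j < n
  · simpa [extendNat, hi, hj, Fin.val_inj] using h
  · have := extendNat_lt α hi
    rw [h] at this
    simp [extendNat, hj] at this
  · have := extendNat_lt α hj
    rw [← h] at this
    simp [extendNat, hi] at this
  · simpa [extendNat, hi, hj] using h

/-- A reduced permutation has no cycle consisting of cyclically consecutive points. -/
theorem IsReducedPerm.extendNat_ne {n : ℕ} {α : Equiv.Perm (Fin n)} (hred : IsReducedPerm α)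
    {i p : ℕ} (hi : i < n) (hp : p < n)
    (h : ∀ t, t < p → extendNat α ((i + t) % n) = (i + (t + 1)) % n) :
    extendNat α ((i + p) % n) ≠ i := by
  intro h'
  refine hred ⟨⟨i, hi⟩, p, hp, fun t ht => Fin.ext ?_, Fin.ext ?_⟩
  · rw [← extendNat_val, finRotate_pow_val, finRotate_pow_val, h t ht]
  · rw [← extendNat_val, finRotate_pow_val, h']

theorem IsReducedPerm.extendNat_ne_of_le {n : ℕ} {α : Equiv.Perm (Fin n)}
    (hred : IsReducedPerm α) {p q : ℕ} (hpq : p ≤ q) (hq : q < n)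
    (h : ∀ x, p ≤ x → x < q → extendNat α x = x + 1) : extendNat α q ≠ p := by
  have := hred.extendNat_ne (i := p) (p := q - p) (by omega) (by omega) fun t ht => by
    rw [Nat.mod_eq_of_lt (by omega), Nat.mod_eq_of_lt (by omega), h _ (by omega) (by omega)]
    rfl
  rwa [Nat.mod_eq_of_lt (by omega), Nat.add_sub_cancel' hpq] at this

theorem exists_isLeast_of_nonempty {n : ℕ} {S : Set (Fin n)} (hS : S.Nonempty) :
    ∃ a, IsLeast S a :=
  ⟨wellFounded_lt.min S hS, wellFounded_lt.min_mem S hS, fun _ hx => wellFounded_lt.min_le hx⟩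

/-- Every reduced genus-one permutation `α` of `{1,…,n}` has a canonical sequence of
separating points: writing `v x = x + 1` for the 1-indexed value of `x : Fin n`,
(i) there is a least `a` with `α(a) ≠ a + 1`; (ii) there is a least `b > a` with
`α(b) > α(a)` or `α(b) ≤ a`; (iii) with `c = α(a) − 1`, and `d = n` if `α(b) = 1`
while `d = α(b) − 1` otherwise, one has `a < b ≤ c < d` and
`z(α) + z(α⁻¹ ∘ ζₙ ∘ (a c) ∘ (b d)) = n + 1`, i.e. `(a,b,c,d)` is a sequence of
separating points for `α`. -/
theorem canonical_separating_points (n : ℕ) (α : Equiv.Perm (Fin n))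
    (hred : IsReducedPerm α) (hg : IsGenusOne α) :
    ∃ a b c d : Fin n,
      IsLeast {x : Fin n | (α x : ℕ) ≠ (x : ℕ) + 1} a ∧
      IsLeast {x : Fin n | a < x ∧ ((α a : ℕ) < (α x : ℕ) ∨ (α x : ℕ) ≤ (a : ℕ))} b ∧
      (c : ℕ) + 1 = (α a : ℕ) ∧
      (((α b : ℕ) = 0 ∧ (d : ℕ) + 1 = n) ∨
        ((α b : ℕ) ≠ 0 ∧ (d : ℕ) + 1 = (α b : ℕ))) ∧
      a < b ∧ b ≤ c ∧ c < d ∧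
      zPerm α +
        zPerm (α⁻¹ * (finRotate n * Equiv.swap a c * Equiv.swap b d)) = n + 1 := by
  unfold IsGenusOne at hg
  have hn : 0 < n := by
    rcases Nat.eq_zero_or_pos n with rfl | h
    · omega
    · exact h
  have hA := extendNat_injective α
  have hR : ∀ p q, p ≤ q → q < n → (∀ x, p ≤ x → x < q → extendNat α x = x + 1) →
      extendNat α q ≠ p := fun p q => hred.extendNat_ne_of_le
  obtain ⟨a, haA, hmin⟩ := exists_isLeast_of_nonempty
    (S := {x : Fin n | (α x : ℕ) ≠ (x : ℕ) + 1})
    ⟨⟨n - 1, by omega⟩, by have := (α ⟨n - 1, by omega⟩).2; simp only [Set.mem_ofPred_eq]; omega⟩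
  have hmin' : ∀ x : ℕ, x < a → extendNat α x = x + 1 := by
    intro x hx
    by_contra h
    rw [← Fin.val_mk (n := n) (by omega : x < n), extendNat_val] at h
    have := Fin.le_def.1 (hmin h)
    simp only at this
    omega
  have notmem : ∀ x : ℕ, a ≤ x → ¬ (0 < extendNat α x ∧ extendNat α x ≤ a) := by
    intro x hx h
    have h1 := hmin' (extendNat α x - 1) (by omega)
    have := hA (show extendNat α (extendNat α x - 1) = extendNat α x by omega)
    omega
  have ha0 : (α a : ℕ) ≠ 0 := by
    have := hR 0 a (by omega) a.2 fun x _ hx => hmin' x hx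
    rwa [extendNat_val] at this
  have haa := notmem a le_rfl
  rw [extendNat_val] at haa
  simp only [Set.mem_ofPred_eq] at haA
  have hpre : a < α⁻¹ ⟨0, hn⟩ := by
    by_contra! h
    rcases h.lt_or_eq with h | h
    · have h1 := hmin' _ h
      rw [extendNat_val] at h1
      simp at h1
    · rw [← h] at ha0
      simp at ha0
  obtain ⟨b, hbS, hbmin⟩ := exists_isLeast_of_nonempty
    (S := {x : Fin n | a < x ∧ ((α a : ℕ) < (α x : ℕ) ∨ (α x : ℕ) ≤ (a : ℕ))})
    ⟨α⁻¹ ⟨0, hn⟩, hpre, Or.inr (by simp)⟩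
  have hab := hbS.1
  obtain ⟨c, hc⟩ : ∃ c : Fin n, (c : ℕ) + 1 = α a :=
    ⟨⟨α a - 1, by omega⟩, by simp only; omega⟩
  have hbc : b ≤ c := by
    by_contra! hcb
    have hs : ∀ x : ℕ, a < x → x ≤ c → (a : ℕ) < extendNat α x ∧ extendNat α x ≤ c := by
      intro x hx hxc
      have hxn : x < n := by omega
      have h1 : (⟨x, hxn⟩ : Fin n) ∉
          {x : Fin n | a < x ∧ ((α a : ℕ) < (α x : ℕ) ∨ (α x : ℕ) ≤ (a : ℕ))} := fun h => by
        have := Fin.le_def.1 (hbmin h)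
        simp only at this
        omega
      simp only [Set.mem_ofPred_eq, Fin.lt_def, ← extendNat_val] at h1
      have h2 : extendNat α x ≠ extendNat α a := fun h => by have := hA h; omega
      rw [← extendNat_val] at hc
      omega
    obtain ⟨a₁, b₁, c₁, d₁, h₁⟩ := exists_crossing_of_mapsTo_Icc hA hR (a + 1) c (by omega)
      (by omega) c.2 fun x h1 h2 => hs x h1 h2
    obtain ⟨e, f, h, h₂⟩ := exists_crossing_right hA (fun x => extendNat_lt α) hR
      (a := a) (c := c) (by omega) (by omega) (by rw [extendNat_val, hc]) hmin' hs (by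
        rintro ⟨h1, h2⟩
        have hcn : (c : ℕ) + 1 < n := by omega
        refine hred.extendNat_ne (i := c + 1) (p := n - 1 - c + a) hcn (by omega)
          (fun t ht => ?_) ?_
        · rcases Nat.lt_or_ge (c + 1 + t) n with h3 | h3
          · rw [Nat.mod_eq_of_lt h3]
            rcases Nat.lt_or_ge (c + 1 + t + 1) n with h4 | h4
            · rw [h2 _ (by omega) h4, Nat.mod_eq_of_lt (by omega)]
              omega
            · rw [show c + 1 + t = n - 1 by omega, h1, show c + 1 + (t + 1) = n by omega,
                Nat.mod_self]
          · rw [Nat.mod_eq_sub_mod h3, Nat.mod_eq_of_lt (by omega), hmin' _ (by omega),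
              Nat.mod_eq_sub_mod (by omega), Nat.mod_eq_of_lt (by omega)]
            omega
        · rw [show c + 1 + (n - 1 - c + a) = a + n by omega, Nat.add_mod_right,
            Nat.mod_eq_of_lt a.2, extendNat_val, hc])
    have hval : ∀ {i j : ℕ} (hi : i < n), extendNat α i = j → (α ⟨i, hi⟩ : ℕ) = j :=
      fun hi h => by rw [← extendNat_val]; exact h
    have hf : f < n := by omega
    have := zPerm_add_two_le_of_crossings (α := α) (a := ⟨a₁, by omega⟩) (b := ⟨b₁, by omega⟩)
      (c := ⟨c₁, by omega⟩) (d := ⟨d₁, by omega⟩) (e := ⟨e, by omega⟩) (f := ⟨f, hf⟩)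
      (h := ⟨h, by omega⟩) (by simp only [Fin.lt_def]; omega) (by simp only [Fin.le_def]; omega)
      (by simp only [Fin.lt_def]; omega) (by simp only [Fin.lt_def]; omega)
      (by simp only [Fin.lt_def]; omega) (by simp only [Fin.le_def]; omega)
      (hval _ (by simp only; omega)) (hval _ (by simp only; omega)) (hval _ (by simp only; omega))
      (by rw [Fin.le_def, hval hf rfl]; simp only; omega)
    omega
  have hbn := notmem b hab.le
  rw [extendNat_val] at hbn
  obtain ⟨d, hd⟩ : ∃ d : Fin n, ((α b : ℕ) = 0 ∧ (d : ℕ) + 1 = n) ∨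
      ((α b : ℕ) ≠ 0 ∧ (d : ℕ) + 1 = (α b : ℕ)) := by
    by_cases h : (α b : ℕ) = 0
    · exact ⟨⟨n - 1, by omega⟩, Or.inl ⟨h, by simp only; omega⟩⟩
    · exact ⟨⟨α b - 1, by omega⟩, Or.inr ⟨h, by simp only; omega⟩⟩
  have hcd : c < d := by
    have := hbS.2
    omega
  refine ⟨a, b, c, d, ⟨haA, hmin⟩, ⟨hbS, hbmin⟩, hc, hd, hab, hbc, hcd, ?_⟩
  have ζc : finRotate n c = α a := by
    apply Fin.ext
    rw [finRotate_val, hc, Nat.mod_eq_of_lt (α a).2]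
  have ζd : finRotate n d = α b := by
    apply Fin.ext
    rw [finRotate_val]
    rcases hd with ⟨h1, h2⟩ | ⟨h1, h2⟩
    · rw [h1, h2, Nat.mod_self]
    · rw [h2, Nat.mod_eq_of_lt (α b).2]
  have nac : a ≠ c := by omega
  have nbd : b ≠ d := by omega
  have nad : d ≠ a := by omega
  have z1 := zPerm_mul_swap_s16 (β := α⁻¹ * finRotate n) nac (by simp [ζc])
  have z2 := zPerm_mul_swap_s16 (β := α⁻¹ * finRotate n * Equiv.swap a c) nbd (by
    simp [Equiv.swap_apply_of_ne_of_ne nad hcd.ne', ζd])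
  rw [← mul_assoc, ← mul_assoc]
  omega
end
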